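/- Let K be a field and (A,▷,◁,B) a finite-dimensional quadratic special apre-perm algebra over K. Suppose r ∈ A⊗A satisfies f(x)(r+τ(r)) = 0 and g(x)(r+τ(r)) = 0 for all x ∈ A, and define R : A → A by R(x) = r♯(B♮(x)). Then SA(r) = 0 if and only if for all x,y ∈ A: R(x)▷R(y) = R( R(x)▷y + x▷R(y) − x▷((r+τ(r))♯(B♮(y))) ) and R(x)◁R(y) = R( R(x)◁y + x◁R(y) − x◁((r+τ(r))♯(B♮(y))) ). -/

import Mathlib

open TensorProduct

noncomputable section

namespace Paper

variable {K : Type*} [Field K]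

section Defs

variable {A : Type*} [AddCommGroup A] [Module K A]
variable {V : Type*} [AddCommGroup V] [Module K V]

/-- Commutativity of a bilinear multiplication. -/
def IsComm (m : A →ₗ[K] A →ₗ[K] A) : Prop := ∀ x y, m x y = m y x

/-- Associativity of a bilinear multiplication. -/
def IsAssoc (m : A →ₗ[K] A →ₗ[K] A) : Prop := ∀ x y z, m (m x y) z = m x (m y z)

/-- `P` is an averaging operator on `(A, m)`. -/
def IsAveragingOp (m : A →ₗ[K] A →ₗ[K] A) (P : A →ₗ[K] A) : Prop :=
  ∀ x y, m (P x) (P y) = P (m (P x) y) ∧ P (m (P x) y) = P (m x (P y))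

/-- `(A, m, P, Q)` is an admissible averaging commutative algebra. -/
def IsAdmissibleAveraging (m : A →ₗ[K] A →ₗ[K] A) (P Q : A →ₗ[K] A) : Prop :=
  IsComm m ∧ IsAssoc m ∧ IsAveragingOp m P ∧
    ∀ x y, m (P x) (Q y) = Q (m (P x) y) ∧ Q (m (P x) y) = Q (m x (Q y))

/-- The flip `τ` on `A ⊗ A`. -/
def tau (r : A ⊗[K] A) : A ⊗[K] A := TensorProduct.comm K A A r

/-- The linear map `A* → A`, `a* ↦ r♯(a*)`, associated with `r ∈ A ⊗ A`,
determined by `⟨r♯(a*), b*⟩ = ⟨r, a* ⊗ b*⟩`. -/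
def sharp (r : A ⊗[K] A) : Module.Dual K A →ₗ[K] A :=
  (TensorProduct.lid K A).toLinearMap ∘ₗ LinearMap.applyₗ r ∘ₗ LinearMap.rTensorHom A

/-- `s ∈ A ⊗ A` is invariant on `(A, m)`:  `(id ⊗ L(x) - L(x) ⊗ id) s = 0` for all `x`. -/
def IsInvariant (m : A →ₗ[K] A →ₗ[K] A) (s : A ⊗[K] A) : Prop :=
  ∀ x : A, LinearMap.lTensor A (m x) s = LinearMap.rTensor A (m x) s

/-- `(u⊗v)⊗(u'⊗v') ↦ b(u⊗u') ⊗ v ⊗ v'`. -/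
def place1 (b : A ⊗[K] A →ₗ[K] A) :
    (A ⊗[K] A) ⊗[K] (A ⊗[K] A) →ₗ[K] A ⊗[K] (A ⊗[K] A) :=
  LinearMap.rTensor (A ⊗[K] A) b ∘ₗ (TensorProduct.tensorTensorTensorComm K A A A A).toLinearMap

/-- `(u⊗v)⊗(u'⊗v') ↦ u ⊗ b(v⊗u') ⊗ v'`. -/
def place2 (b : A ⊗[K] A →ₗ[K] A) :
    (A ⊗[K] A) ⊗[K] (A ⊗[K] A) →ₗ[K] A ⊗[K] (A ⊗[K] A) :=
  LinearMap.lTensor A (LinearMap.rTensor A b) ∘ₗ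
    LinearMap.lTensor A (TensorProduct.assoc K A A A).symm.toLinearMap ∘ₗ
      (TensorProduct.assoc K A A (A ⊗[K] A)).toLinearMap

/-- `(u⊗v)⊗(u'⊗v') ↦ u ⊗ u' ⊗ b(v⊗v')`. -/
def place3 (b : A ⊗[K] A →ₗ[K] A) :
    (A ⊗[K] A) ⊗[K] (A ⊗[K] A) →ₗ[K] A ⊗[K] (A ⊗[K] A) :=
  (TensorProduct.assoc K A A A).toLinearMap ∘ₗ LinearMap.lTensor (A ⊗[K] A) b ∘ₗ
    (TensorProduct.tensorTensorTensorComm K A A A A).toLinearMap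

/-- A bilinear multiplication as a linear map on the tensor square. -/
def liftM (m : A →ₗ[K] A →ₗ[K] A) : A ⊗[K] A →ₗ[K] A := TensorProduct.lift m

/-- The opposite multiplication as a linear map on the tensor square: `u ⊗ v ↦ m v u`. -/
def flipM (m : A →ₗ[K] A →ₗ[K] A) : A ⊗[K] A →ₗ[K] A :=
  TensorProduct.lift m ∘ₗ (TensorProduct.comm K A A).toLinearMap

/-- For `r = Σᵢ uᵢ ⊗ vᵢ`, the element
`𝐀(r) = Σᵢⱼ (uᵢ·uⱼ)⊗vᵢ⊗vⱼ − uᵢ⊗(uⱼ·vᵢ)⊗vⱼ + uᵢ⊗uⱼ⊗(vᵢ·vⱼ)` of `A⊗A⊗A`. -/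
def Acal (m : A →ₗ[K] A →ₗ[K] A) (r : A ⊗[K] A) : A ⊗[K] (A ⊗[K] A) :=
  place1 (liftM m) (r ⊗ₜ[K] r) - place2 (flipM m) (r ⊗ₜ[K] r) + place3 (liftM m) (r ⊗ₜ[K] r)

/-- `r` is a solution of the averaging associative Yang–Baxter equation (AAYBE) in
`(A, m, P, Q)`: `𝐀(r) = 0`, `(P⊗id − id⊗Q)(r) = 0` and `(Q⊗id − id⊗P)(r) = 0`. -/
def IsAAYBESolution (m : A →ₗ[K] A →ₗ[K] A) (P Q : A →ₗ[K] A) (r : A ⊗[K] A) : Prop :=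
  Acal m r = 0 ∧ LinearMap.rTensor A P r = LinearMap.lTensor A Q r ∧
    LinearMap.rTensor A Q r = LinearMap.lTensor A P r

/-- The co-multiplication `Δ_r : x ↦ (id ⊗ L(x) − L(x) ⊗ id)(r)`. -/
def DeltaMap (m : A →ₗ[K] A →ₗ[K] A) (r : A ⊗[K] A) : A →ₗ[K] A ⊗[K] A :=
  (LinearMap.applyₗ r ∘ₗ LinearMap.lTensorHom A) ∘ₗ m -
    (LinearMap.applyₗ r ∘ₗ LinearMap.rTensorHom A) ∘ₗ m

/-- The dual representation map `x ↦ (ρ(x))*`. -/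
def dualRep (ρ : A →ₗ[K] V →ₗ[K] V) : A →ₗ[K] Module.Dual K V →ₗ[K] Module.Dual K V :=
  Module.Dual.transpose ∘ₗ ρ

/-- `(ρ, α, β, V)` is a representation of the admissible averaging commutative algebra
`(A, m, P, Q)`. -/
def IsRep (m : A →ₗ[K] A →ₗ[K] A) (P Q : A →ₗ[K] A)
    (ρ : A →ₗ[K] V →ₗ[K] V) (α β : V →ₗ[K] V) : Prop :=
  (∀ x y v, ρ (m x y) v = ρ x (ρ y v)) ∧
  (∀ x v, ρ (P x) (α v) = α (ρ (P x) v) ∧ α (ρ (P x) v) = α (ρ x (α v))) ∧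
  (∀ x v, ρ (P x) (β v) = β (ρ (P x) v) ∧ β (ρ (P x) v) = β (ρ x (β v))) ∧
  (∀ x v, ρ (Q x) (α v) = β (ρ x (α v)) ∧ β (ρ x (α v)) = β (ρ (Q x) v))

/-- `(ρ, α, β, V, mV)` is an `(A, m, P, Q)`-representation algebra. -/
def IsRepAlg (m : A →ₗ[K] A →ₗ[K] A) (P Q : A →ₗ[K] A)
    (ρ : A →ₗ[K] V →ₗ[K] V) (α β : V →ₗ[K] V) (mV : V →ₗ[K] V →ₗ[K] V) : Prop :=
  IsRep m P Q ρ α β ∧ IsAdmissibleAveraging mV α β ∧ ∀ x u v, ρ x (mV u v) = mV (ρ x u) v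

/-- The semidirect-product multiplication on `A × V`:
`(x+u)·(y+v) = x·y + ρ(x)v + ρ(y)u + u ·_V v`. -/
def sdMul (m : A →ₗ[K] A →ₗ[K] A) (ρ : A →ₗ[K] V →ₗ[K] V) (mV : V →ₗ[K] V →ₗ[K] V) :
    (A × V) →ₗ[K] (A × V) →ₗ[K] (A × V) :=
  LinearMap.mk₂ K
    (fun p q => (m p.1 q.1, ρ p.1 q.2 + ρ q.1 p.2 + mV p.2 q.2))
    (fun p p' q => by
      simp only [Prod.fst_add, Prod.snd_add, map_add, LinearMap.add_apply, Prod.mk_add_mk,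
        Prod.mk.injEq]
      exact ⟨trivial, by abel⟩)
    (fun c p q => by
      simp only [Prod.smul_fst, Prod.smul_snd, map_smul, LinearMap.smul_apply, Prod.smul_mk,
        smul_add, Prod.mk.injEq])
    (fun p q q' => by
      simp only [Prod.fst_add, Prod.snd_add, map_add, LinearMap.add_apply, Prod.mk_add_mk,
        Prod.mk.injEq]
      exact ⟨trivial, by abel⟩)
    (fun c p q => by
      simp only [Prod.smul_fst, Prod.smul_snd, map_smul, LinearMap.smul_apply, Prod.smul_mk,
        smul_add, Prod.mk.injEq])

/-- Nondegeneracy of a bilinear form. -/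
def IsNondeg (B : A →ₗ[K] A →ₗ[K] K) : Prop := ∀ x, (∀ y, B x y = 0) → x = 0

/-- `(A, m, B)` is a symmetric Frobenius commutative algebra. -/
def IsSymFrob (m : A →ₗ[K] A →ₗ[K] A) (B : A →ₗ[K] A →ₗ[K] K) : Prop :=
  IsComm m ∧ IsAssoc m ∧ (∀ x y, B x y = B y x) ∧ IsNondeg B ∧
    ∀ x y z, B (m x y) z = B x (m y z)

/-- `R` is a Rota–Baxter operator of weight `l` on `(A, m)`. -/
def IsRB (m : A →ₗ[K] A →ₗ[K] A) (R : A →ₗ[K] A) (l : K) : Prop :=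
  ∀ x y, m (R x) (R y) = R (m (R x) y + m x (R y) + l • m x y)

/-- `(A, m, R, B)` is a symmetric Rota–Baxter Frobenius commutative algebra of weight `l`. -/
def IsSymRBFrob (m : A →ₗ[K] A →ₗ[K] A) (R : A →ₗ[K] A) (B : A →ₗ[K] A →ₗ[K] K) (l : K) :
    Prop :=
  IsSymFrob m B ∧ IsRB m R l ∧ ∀ x y, B (R x) y + B x (R y) + l • B x y = 0

/-- `(A, m, P, R, B)` is a symmetric averaging Rota–Baxter Frobenius commutative algebra of
weight `l`. -/
def IsSymAvgRBFrob (m : A →ₗ[K] A →ₗ[K] A) (P R : A →ₗ[K] A) (B : A →ₗ[K] A →ₗ[K] K)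
    (l : K) : Prop :=
  IsSymRBFrob m R B l ∧ IsAveragingOp m P ∧ P ∘ₗ R = R ∘ₗ P

/-- `(A, tr, lt)` is a special apre-perm algebra (with `x ▷ y = tr x y`, `x ◁ y = lt x y`). -/
def IsSAPP (tr lt : A →ₗ[K] A →ₗ[K] A) : Prop :=
  (∀ x y, lt x y = lt y x) ∧
  (∀ x y z, (tr + lt) x ((tr + lt) y z) = (tr + lt) ((tr + lt) x y) z ∧
      (tr + lt) ((tr + lt) x y) z = (tr + lt) ((tr + lt) y x) z) ∧
  (∀ x y z, lt ((tr + lt) x y) z = (tr + lt) x (lt y z) ∧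
      (tr + lt) x (lt y z) = - lt x (lt y z))

/-- `f(x) = id ⊗ R∘(x) + L◁(x) ⊗ id` on `A ⊗ A`. -/
def fmap (tr lt : A →ₗ[K] A →ₗ[K] A) (x : A) : A ⊗[K] A →ₗ[K] A ⊗[K] A :=
  LinearMap.lTensor A ((tr + lt).flip x) + LinearMap.rTensor A (lt x)

/-- `g(x) = L∘(x) ⊗ id − id ⊗ L∘(x)` on `A ⊗ A`. -/
def gmap (tr lt : A →ₗ[K] A →ₗ[K] A) (x : A) : A ⊗[K] A →ₗ[K] A ⊗[K] A :=
  LinearMap.rTensor A ((tr + lt) x) - LinearMap.lTensor A ((tr + lt) x)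

/-- For `r = Σᵢ uᵢ ⊗ vᵢ`, the element
`SA(r) = Σᵢⱼ (uᵢ∘uⱼ)⊗vᵢ⊗vⱼ + uᵢ⊗(vᵢ◁uⱼ)⊗vⱼ + uᵢ⊗uⱼ⊗(vⱼ∘vᵢ)` of `A⊗A⊗A`. -/
def SAcal (tr lt : A →ₗ[K] A →ₗ[K] A) (r : A ⊗[K] A) : A ⊗[K] (A ⊗[K] A) :=
  place1 (liftM (tr + lt)) (r ⊗ₜ[K] r) + place2 (liftM lt) (r ⊗ₜ[K] r) +
    place3 (flipM (tr + lt)) (r ⊗ₜ[K] r)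

/-- `(A, tr, lt, B)` is a quadratic special apre-perm algebra. -/
def IsQuadSAPP (tr lt : A →ₗ[K] A →ₗ[K] A) (B : A →ₗ[K] A →ₗ[K] K) : Prop :=
  IsSAPP tr lt ∧ (∀ x y, B x y = B y x) ∧ IsNondeg B ∧
    ∀ x y z, B (lt x y) z = - B x ((tr + lt) z y)

/-- `(A, tr, lt, R, B)` is a quadratic Rota–Baxter special apre-perm algebra of weight `l`. -/
def IsQuadRBSAPP (tr lt : A →ₗ[K] A →ₗ[K] A) (R : A →ₗ[K] A) (B : A →ₗ[K] A →ₗ[K] K)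
    (l : K) : Prop :=
  IsQuadSAPP tr lt B ∧ IsRB tr R l ∧ IsRB lt R l ∧
    ∀ x y, B (R x) y + B x (R y) + l • B x y = 0

/-- `x ◁ y = −Q(x·y)` as a bilinear map. -/
def ltOf (m : A →ₗ[K] A →ₗ[K] A) (Q : A →ₗ[K] A) : A →ₗ[K] A →ₗ[K] A :=
  - (LinearMap.llcomp K A A A Q ∘ₗ m)

/-- `x ▷ y = P(x)·y + Q(x·y)` as a bilinear map. -/
def trOf (m : A →ₗ[K] A →ₗ[K] A) (P Q : A →ₗ[K] A) : A →ₗ[K] A →ₗ[K] A :=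
  m ∘ₗ P + LinearMap.llcomp K A A A Q ∘ₗ m

/-- The multiplication `a* ◇_s b* = L*(s♯(a*))(b*)` on `A*`. -/
def diamondMap (m : A →ₗ[K] A →ₗ[K] A) (s : A ⊗[K] A) :
    Module.Dual K A →ₗ[K] Module.Dual K A →ₗ[K] Module.Dual K A :=
  dualRep m ∘ₗ sharp s

/-- The natural bilinear form `B_d(x+a*, y+b*) = ⟨a*, y⟩ + ⟨b*, x⟩` on `A × A*`. -/
def pairForm : (A × Module.Dual K A) →ₗ[K] (A × Module.Dual K A) →ₗ[K] K :=
  LinearMap.mk₂ K (fun p q => p.2 q.1 + q.2 p.1)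
    (fun p p' q => by
      simp only [Prod.fst_add, Prod.snd_add, LinearMap.add_apply, map_add]
      ring)
    (fun c p q => by
      simp only [Prod.smul_fst, Prod.smul_snd, LinearMap.smul_apply, map_smul, smul_eq_mul]
      ring)
    (fun p q q' => by
      simp only [Prod.fst_add, Prod.snd_add, LinearMap.add_apply, map_add]
      ring)
    (fun c p q => by
      simp only [Prod.smul_fst, Prod.smul_snd, LinearMap.smul_apply, map_smul, smul_eq_mul]
      ring)

/-- The Zinbiel and admissibility axioms for `(A, ⋆, P, Q)`. -/
def IsAdmAvgZinbiel (st : A →ₗ[K] A →ₗ[K] A) (P Q : A →ₗ[K] A) : Prop :=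
  (∀ x y z, st x (st y z) = st (st x y) z + st (st y x) z) ∧
  (∀ x y, st (P x) (P y) = P (st (P x) y) ∧ P (st (P x) y) = P (st x (P y))) ∧
  (∀ x y, Q (st (P x) y) = st (P x) (Q y) ∧ st (P x) (Q y) = Q (st x (Q y))) ∧
  (∀ x y, Q (st (Q x) y) = st (Q x) (P y) ∧ st (Q x) (P y) = Q (st x (P y)))

end Defs

end Paper

section Theorems

open Paper

variable {K : Type*} [Field K]
variable {A : Type*} [AddCommGroup A] [Module K A]
variable {V : Type*} [AddCommGroup V] [Module K V]

/-- Pairing of `A ⊗ A ⊗ A` with three functionals. -/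
def pair3 (p q s : Module.Dual K A) : A ⊗[K] (A ⊗[K] A) →ₗ[K] K :=
  (TensorProduct.lid K K).toLinearMap ∘ₗ TensorProduct.map p
    ((TensorProduct.lid K K).toLinearMap ∘ₗ TensorProduct.map q s)

theorem pair3_tmul (p q s : Module.Dual K A) (a b c : A) :
    pair3 p q s (a ⊗ₜ[K] (b ⊗ₜ[K] c)) = p a * (q b * s c) := by
  simp [pair3]

theorem pair3_sep [FiniteDimensional K A] (t : A ⊗[K] (A ⊗[K] A))
    (h : ∀ p q s : Module.Dual K A, pair3 p q s t = 0) : t = 0 := by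
  let b := Module.finBasis K A
  apply (b.tensorProduct (b.tensorProduct b)).ext_elem
  rintro ⟨i, j, k⟩
  have key : (Finsupp.lapply (i, j, k)) ∘ₗ
      (b.tensorProduct (b.tensorProduct b)).repr.toLinearMap =
      pair3 (b.coord i) (b.coord j) (b.coord k) := by
    ext x y z
    simp [pair3, Module.Basis.tensorProduct_repr_tmul_apply, mul_comm, mul_assoc, mul_left_comm]
  have h2 := LinearMap.congr_fun key t
  rw [h] at h2
  simpa using h2

theorem sharp_tmul (u v : A) (p : Module.Dual K A) : sharp (u ⊗ₜ[K] v) p = p u • v := by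
  simp [sharp]

theorem sharp_add (r s : A ⊗[K] A) (p : Module.Dual K A) :
    sharp (r + s) p = sharp r p + sharp s p := by
  simp [sharp]

theorem sharp_zero (p : Module.Dual K A) : sharp (0 : A ⊗[K] A) p = 0 := by
  simp [sharp]

theorem tau_tmul (u v : A) : tau (u ⊗ₜ[K] v) = v ⊗ₜ[K] u := by simp [tau]

theorem tau_add (r s : A ⊗[K] A) : tau (r + s) = tau r + tau s := by simp [tau]

theorem tau_zero : tau (0 : A ⊗[K] A) = 0 := by simp [tau]

theorem dual_sharp_tau (r : A ⊗[K] A) (p q : Module.Dual K A) :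
    p (sharp (tau r) q) = q (sharp r p) := by
  induction r using TensorProduct.induction_on with
  | zero => simp [tau_zero, sharp_zero]
  | tmul u v => simp [tau_tmul, sharp_tmul, mul_comm]
  | add a b ha hb => simp [tau_add, sharp_add, ha, hb]

theorem sharp_lTensor (h : A →ₗ[K] A) (r : A ⊗[K] A) (p : Module.Dual K A) :
    sharp (LinearMap.lTensor A h r) p = h (sharp r p) := by
  induction r using TensorProduct.induction_on with
  | zero => simp [sharp_zero]
  | tmul u v => simp [sharp_tmul]
  | add a b ha hb => simp [sharp_add, ha, hb]

theorem sharp_rTensor (h : A →ₗ[K] A) (r : A ⊗[K] A) (p : Module.Dual K A) :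
    sharp (LinearMap.rTensor A h r) p = sharp r (p ∘ₗ h) := by
  induction r using TensorProduct.induction_on with
  | zero => simp [sharp_zero]
  | tmul u v => simp [sharp_tmul]
  | add a b ha hb => simp [sharp_add, ha, hb]

theorem pair_place1 (m : A →ₗ[K] A →ₗ[K] A) (p q s : Module.Dual K A) (r r' : A ⊗[K] A) :
    pair3 p q s (place1 (liftM m) (r ⊗ₜ[K] r')) =
      p (m (sharp (tau r) q) (sharp (tau r') s)) := by
  induction r using TensorProduct.induction_on with
  | zero => simp [tau_zero, sharp_zero]
  | add a b ha hb => simp [tau_add, sharp_add, ha, hb, TensorProduct.add_tmul]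
  | tmul u v =>
    induction r' using TensorProduct.induction_on with
    | zero => simp [tau_zero, sharp_zero]
    | add a b ha hb =>
      simp only [tau_add, sharp_add, TensorProduct.tmul_add, map_add, ha, hb]
    | tmul u' v' =>
      simp [tau_tmul, sharp_tmul, place1, Paper.liftM, pair3_tmul]; ring

theorem pair_place2 (m : A →ₗ[K] A →ₗ[K] A) (p q s : Module.Dual K A) (r r' : A ⊗[K] A) :
    pair3 p q s (place2 (liftM m) (r ⊗ₜ[K] r')) =
      q (m (sharp r p) (sharp (tau r') s)) := by
  induction r using TensorProduct.induction_on with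
  | zero => simp [sharp_zero]
  | add a b ha hb => simp [sharp_add, ha, hb, TensorProduct.add_tmul]
  | tmul u v =>
    induction r' using TensorProduct.induction_on with
    | zero => simp [tau_zero, sharp_zero]
    | add a b ha hb =>
      simp only [tau_add, sharp_add, TensorProduct.tmul_add, map_add, ha, hb]
    | tmul u' v' =>
      simp [tau_tmul, sharp_tmul, place2, Paper.liftM, pair3_tmul]; ring

theorem pair_place3 (m : A →ₗ[K] A →ₗ[K] A) (p q s : Module.Dual K A) (r r' : A ⊗[K] A) :
    pair3 p q s (place3 (flipM m) (r ⊗ₜ[K] r')) =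
      s (m (sharp r' q) (sharp r p)) := by
  induction r using TensorProduct.induction_on with
  | zero => simp [sharp_zero]
  | add a b ha hb => simp [sharp_add, ha, hb, TensorProduct.add_tmul]
  | tmul u v =>
    induction r' using TensorProduct.induction_on with
    | zero => simp [sharp_zero]
    | add a b ha hb =>
      simp only [sharp_add, TensorProduct.tmul_add, map_add, LinearMap.add_apply, ha, hb]
    | tmul u' v' =>
      simp [sharp_tmul, place3, flipM, pair3_tmul]

theorem sappYBE_iff_RB_like [FiniteDimensional K A]
    (tr lt : A →ₗ[K] A →ₗ[K] A) (B : A →ₗ[K] A →ₗ[K] K)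
    (hquad : IsQuadSAPP tr lt B)
    (r : A ⊗[K] A)
    (hf : ∀ x : A, fmap tr lt x (r + tau r) = 0)
    (hg : ∀ x : A, gmap tr lt x (r + tau r) = 0)
    (R : A →ₗ[K] A) (hR : ∀ x, R x = sharp r (B x)) :
    SAcal tr lt r = 0 ↔
      ∀ x y,
        (tr (R x) (R y) = R (tr (R x) y + tr x (R y) - tr x (sharp (r + tau r) (B y)))) ∧
        (lt (R x) (R y) = R (lt (R x) y + lt x (R y) - lt x (sharp (r + tau r) (B y)))) := by
  obtain ⟨⟨hcomm, -, -⟩, hsym, hnd, hinv⟩ := hquad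
  obtain ⟨m, hm⟩ : ∃ m, m = tr + lt := ⟨_, rfl⟩
  have htr : tr = m - lt := by rw [hm]; abel
  rw [← hm] at hinv
  -- separation by the form
  have sep : ∀ a b : A, (∀ z, B z a = B z b) → a = b := by
    intro a b h
    rw [← sub_eq_zero]
    apply hnd
    intro z
    rw [hsym, map_sub, h z, sub_self]
  -- adjoints of the multiplication operators
  have adjL : ∀ x a b, B a (m x b) = B (m x a) b := by
    intro x a b
    have h1 := hinv a b x
    have h2 := hinv b a x
    rw [hcomm b a] at h2
    rw [hsym (m x a) b]
    linear_combination h1 - h2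
  have adjR : ∀ x a b, B a (m b x) = - B (lt a x) b := by
    intro x a b
    rw [hinv a x b]; ring
  -- the operators
  obtain ⟨S, hS⟩ : ∃ S : A →ₗ[K] A, ∀ x, S x = sharp (r + tau r) (B x) :=
    ⟨sharp (r + tau r) ∘ₗ B, fun _ => rfl⟩
  have htau : ∀ x, sharp (tau r) (B x) = S x - R x := by
    intro x; rw [hS, hR, sharp_add]; abel
  have adjRt : ∀ x y, B x (S y - R y) = B (R x) y := by
    intro x y
    rw [← htau, dual_sharp_tau, ← hR, hsym]
  have symS : ∀ x y, B x (S y) = B (S x) y := by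
    intro x y
    have h1 := adjRt x y
    have h2 := adjRt y x
    rw [map_sub] at h1 h2
    rw [hsym (S x) y]
    have h3 := hsym (R x) y
    have h4 := hsym (R y) x
    linear_combination h1 - h2 + h3 - h4
  have Sr : ∀ a x, S (m a x) = m (S a) x := by
    intro a x
    have h := hf x
    rw [fmap, ← hm, LinearMap.add_apply] at h
    have h1 := congrArg (fun t => sharp t (B a)) h
    beta_reduce at h1
    rw [sharp_add, sharp_lTensor, sharp_rTensor, sharp_zero] at h1
    have e : B a ∘ₗ lt x = - B (m a x) := by
      ext u
      simp only [LinearMap.comp_apply, LinearMap.neg_apply]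
      rw [hsym a, hcomm x u, hinv, hsym u]
    rw [e, map_neg, ← hS, ← hS, LinearMap.flip_apply] at h1
    rw [← sub_eq_zero, ← neg_eq_zero, ← h1]; abel
  have Sl : ∀ a x, S (m x a) = m x (S a) := by
    intro a x
    have h := hg x
    rw [gmap, ← hm, LinearMap.sub_apply, sub_eq_zero] at h
    have h1 := congrArg (fun t => sharp t (B a)) h
    simp only [sharp_lTensor, sharp_rTensor] at h1
    have e : B a ∘ₗ m x = B (m x a) := by
      ext u
      simp only [LinearMap.comp_apply, adjL]
    rwa [e, ← hS, ← hS] at h1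
  have St : ∀ b x, S (lt b x) = lt (S b) x := by
    intro b x
    apply sep
    intro a
    have h1 : B (S b) (m a x) = B b (m (S a) x) := by rw [← symS, Sr]
    rw [adjR, adjR] at h1
    rw [symS, hsym (S a), hsym a]
    linear_combination h1
  have St' : ∀ b x, lt (S b) x = lt b (S x) := by
    intro b x
    rw [← St, hcomm b x, St, hcomm]
  -- the equation for SA
  have main : SAcal tr lt r = 0 ↔ ∀ x y, m (R y) (R x) = R (m y (R x) + m (R y) x - m y (S x)) := by
    have pairing : ∀ x y z, pair3 (B x) (B y) (B z) (SAcal tr lt r) =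
        B z (m (R y) (R x) - R (m y (R x) + m (R y) x - m y (S x))) := by
      intro x y z
      rw [SAcal, map_add, map_add, pair_place1, pair_place2, pair_place3, ← hm]
      simp only [htau, ← hR]
      have t1 : B x (m (S y - R y) (S z - R z)) = B z (R (m y (S x) - m (R y) x)) := by
        rw [adjL, adjRt, hsym, map_sub m, LinearMap.sub_apply, ← Sr, Sl]
      have t2 : B y (lt (R x) (S z - R z)) = - B z (R (m y (R x))) := by
        rw [hsym, hcomm, hinv, hsym, adjRt, hsym]
      rw [t1, t2]
      simp only [map_sub, map_add]
      ring
    constructor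
    · intro h x y
      apply sep
      intro z
      have := pairing x y z
      rw [h, map_zero, map_sub] at this
      exact (sub_eq_zero.mp this.symm)
    · intro h
      apply pair3_sep
      have surj : Function.Surjective B := by
        apply (LinearMap.injective_iff_surjective_of_finrank_eq_finrank
          (Subspace.dual_finrank_eq (K := K) (V := A)).symm).mp
        rw [injective_iff_map_eq_zero]
        intro a ha
        exact hnd a (fun y => by rw [ha]; rfl)
      intro p q s
      obtain ⟨x, rfl⟩ := surj p
      obtain ⟨y, rfl⟩ := surj q
      obtain ⟨z, rfl⟩ := surj s
      rw [pairing, h, sub_self, map_zero]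
  rw [main]
  simp only [← hS]
  constructor
  · intro h
    have hlt : ∀ x y, lt (R x) (R y) = R (lt (R x) y + lt x (R y) - lt x (S y)) := by
      intro z x
      apply sep
      intro y
      have h1 := congrArg (B z) (h x y)
      have a1 : B z (m (R y) (R x)) = - B y (S (lt z (R x)) - R (lt z (R x))) := by
        rw [adjR, adjRt, hsym]
      have a2 : B z (R (m y (R x))) = - B y (lt (S z - R z) (R x)) := by
        rw [hsym, ← adjRt, hsym, adjR, hsym]
      have a3 : B z (R (m y (S x) - m (R y) x)) = - B y (R (lt (S z - R z) x)) := by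
        rw [← Sl, Sr, ← LinearMap.sub_apply, ← map_sub, hsym, ← adjRt, hsym, adjR, adjRt, hsym]
      rw [a1] at h1
      simp only [map_add, map_sub, LinearMap.sub_apply, St, St'] at h1 a2 a3 ⊢
      linear_combination -h1 - a2 + a3
    intro x y
    refine ⟨?_, hlt x y⟩
    rw [htr]
    simp only [LinearMap.sub_apply]
    rw [h, hlt, ← map_sub]
    congr 1
    abel
  · intro h x y
    obtain ⟨h1, h2⟩ := h y x
    rw [hm]
    simp only [LinearMap.add_apply]
    rw [h1, h2, ← map_add]
    congr 1
    abel

end Theorems
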